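/- Let T and T' be complete L_⊗-theories extending T_MSO(Fin). Then for any models M ⊨ T and N ⊨ T', the complete theory Th(M ⊗ N) does not depend on the choice of M and N; setting T ⊗ T' := Th(M ⊗ N) gives a well-defined binary operation on the set of complete extensions of T_MSO(Fin), and T ⊗ T' is itself a complete extension of T_MSO(Fin). -/

import Mathlib

open FirstOrder FirstOrder.Language

namespace MSO

/-! ### The language `L_⊗` and its semantics -/

/-- The language `L_⊗`: a constant `⊥`, a unary relation `At`,
and two binary relations: `⊆` (encoded `true`) and `≤ᴱ` (encoded `false`). -/
def Lmso : Language where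
  Functions := fun n => match n with | 0 => Unit | _ => Empty
  Relations := fun n => match n with | 1 => Unit | 2 => Bool | _ => Empty

/-- The constant symbol `⊥`. -/
def botC : Lmso.Constants := Unit.unit
/-- The unary relation symbol `At`. -/
def atR : Lmso.Relations 1 := Unit.unit
/-- The binary relation symbol `⊆`. -/
def subR : Lmso.Relations 2 := true
/-- The binary relation symbol `≤ᴱ`. -/
def exleR : Lmso.Relations 2 := false

/-- The interpretation of `⊥` in an `L_⊗`-structure. -/
def botE (M : Type*) [Lmso.Structure M] : M := Structure.funMap botC ![]
/-- The interpretation of `At` in an `L_⊗`-structure. -/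
def atE {M : Type*} [Lmso.Structure M] (a : M) : Prop := Structure.RelMap atR ![a]
/-- The interpretation of `⊆` in an `L_⊗`-structure. -/
def subE {M : Type*} [Lmso.Structure M] (a b : M) : Prop := Structure.RelMap subR ![a, b]
/-- The interpretation of `≤ᴱ` in an `L_⊗`-structure. -/
def exleE {M : Type*} [Lmso.Structure M] (a b : M) : Prop := Structure.RelMap exleR ![a, b]

/-- The monadic second order version `M̃SO(α)` of a linear order `α`, as an `L_⊗`-structure:
the universe is the powerset of `α`, `⊆` is inclusion, `⊥` is `∅`, `At` holds of singletons,
and `A ≤ᴱ B` iff there are `a ∈ A` and `b ∈ B` with `a < b`. -/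
instance msoStructure (α : Type*) [LinearOrder α] : Lmso.Structure (Set α) where
  funMap := fun {n} f _ => match n, f with
    | 0, _ => (∅ : Set α)
  RelMap := fun {n} r v => match n, r with
    | 1, _ => ∃ a : α, v 0 = {a}
    | 2, true => v 0 ⊆ v 1
    | 2, false => ∃ a ∈ v 0, ∃ b ∈ v 1, a < b

/-- `MSO(n)`, the monadic second order version of the `n`-element linear order. -/
abbrev MSOn (n : ℕ) : Type := Set (Fin n)

/-- The operation `⊗` on `L_⊗`-structures: the universe is the product, `⊆` is componentwise,
`⊥` is the pair of bottoms, `At` holds of the atoms (minimal non-bottom elements) of the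
resulting order, and `(A,B) ≤ᴱ (C,D)` iff (`A ≠ ⊥` and `D ≠ ⊥`), or `A ≤ᴱ C`, or `B ≤ᴱ D`. -/
instance tensorStructure (M N : Type*) [Lmso.Structure M] [Lmso.Structure N] :
    Lmso.Structure (M × N) where
  funMap := fun {n} f _ => match n, f with
    | 0, _ => (botE M, botE N)
  RelMap := fun {n} r v => match n, r with
    | 1, _ => v 0 ≠ (botE M, botE N) ∧
        ∀ q : M × N, subE q.1 (v 0).1 → subE q.2 (v 0).2 →
          q = (botE M, botE N) ∨ q = v 0
    | 2, true => subE (v 0).1 (v 1).1 ∧ subE (v 0).2 (v 1).2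
    | 2, false => ((v 0).1 ≠ botE M ∧ (v 1).2 ≠ botE N) ∨
        exleE (v 0).1 (v 1).1 ∨ exleE (v 0).2 (v 1).2

/-! ### Formulas -/

/-- Bounded `L_⊗`-formulas with no free (outer) variables. -/
abbrev BF (n : ℕ) := Lmso.BoundedFormula Empty n

/-- The `i`-th de Bruijn variable as a term. -/
def tv {n : ℕ} (i : Fin n) : Lmso.Term (Empty ⊕ Fin n) := Term.var (Sum.inr i)
/-- The constant `⊥` as a term. -/
def tb {n : ℕ} : Lmso.Term (Empty ⊕ Fin n) := Constants.term botC

def sub' {n : ℕ} (i j : Fin n) : BF n := subR.boundedFormula₂ (tv i) (tv j)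
def exle' {n : ℕ} (i j : Fin n) : BF n := exleR.boundedFormula₂ (tv i) (tv j)
def at' {n : ℕ} (i : Fin n) : BF n := atR.boundedFormula₁ (tv i)
def eq' {n : ℕ} (i j : Fin n) : BF n := Term.bdEqual (tv i) (tv j)
def isBot' {n : ℕ} (i : Fin n) : BF n := Term.bdEqual (tv i) tb
def botSub' {n : ℕ} (i : Fin n) : BF n := subR.boundedFormula₂ tb (tv i)

/-- Finite conjunction. -/
def bigAnd {n : ℕ} (l : List (BF n)) : BF n := l.foldr (· ⊓ ·) ⊤
/-- Finite disjunction. -/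
def bigOr {n : ℕ} (l : List (BF n)) : BF n := l.foldr (· ⊔ ·) ⊥

/-- `k` is the meet of `i` and `j` (with respect to `⊆`). -/
def isMeet {n : ℕ} (k i j : Fin n) : BF n :=
  sub' k i ⊓ sub' k j ⊓
    ∀' ((sub' (Fin.last n) i.castSucc ⊓ sub' (Fin.last n) j.castSucc) ⟹
      sub' (Fin.last n) k.castSucc)

/-- `k` is the join of `i` and `j` (with respect to `⊆`). -/
def isJoin {n : ℕ} (k i j : Fin n) : BF n :=
  sub' i k ⊓ sub' j k ⊓
    ∀' ((sub' i.castSucc (Fin.last n) ⊓ sub' j.castSucc (Fin.last n)) ⟹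
      sub' k.castSucc (Fin.last n))

/-- The meet of `i` and `j` is `⊥`. -/
def meetIsBot {n : ℕ} (i j : Fin n) : BF n :=
  ∀' ((sub' (Fin.last n) i.castSucc ⊓ sub' (Fin.last n) j.castSucc) ⟹ isBot' (Fin.last n))

/-- The join of `i` and `j` is the top element. -/
def joinIsTop {n : ℕ} (i j : Fin n) : BF n :=
  ∀' ((sub' i.castSucc (Fin.last n) ⊓ sub' j.castSucc (Fin.last n)) ⟹
    ∀' (sub' (Fin.last (n + 1)) ((Fin.last n).castSucc)))

/-- `j` is a (Boolean) complement of `i`. -/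
def isComplOf {n : ℕ} (j i : Fin n) : BF n := meetIsBot i j ⊓ joinIsTop i j

/-- `i` is an atom: non-bottom, and minimal among non-bottom elements. -/
def isAtomDef {n : ℕ} (i : Fin n) : BF n :=
  ∼(isBot' i) ⊓
    ∀' (sub' (Fin.last n) i.castSucc ⟹ (isBot' (Fin.last n) ⊔ eq' (Fin.last n) i.castSucc))

/-! ### The base theory `T_base` -/

def axRefl : Lmso.Sentence := ∀' sub' 0 0
def axAntisymm : Lmso.Sentence := ∀' ∀' ((sub' 0 1 ⊓ sub' 1 0) ⟹ eq' 0 1)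
def axTrans : Lmso.Sentence := ∀' ∀' ∀' ((sub' 0 1 ⊓ sub' 1 2) ⟹ sub' 0 2)
def axBotLe : Lmso.Sentence := ∀' botSub' 0
def axTop : Lmso.Sentence := ∃' ∀' (sub' 1 0)
def axMeet : Lmso.Sentence := ∀' ∀' ∃' (isMeet 2 0 1)
def axJoin : Lmso.Sentence := ∀' ∀' ∃' (isJoin 2 0 1)
def axCompl : Lmso.Sentence := ∀' ∃' (isComplOf 1 0)
def axDistrib : Lmso.Sentence :=
  ∀' ∀' ∀' ∀' ∀' ∀' ∀' ∀'
    ((isMeet 3 0 1 ⊓ isMeet 4 0 2 ⊓ isJoin 5 1 2 ⊓ isMeet 6 0 5 ⊓ isJoin 7 3 4) ⟹ sub' 6 7)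
def axAt : Lmso.Sentence := ∀' (at' 0 ⇔ isAtomDef 0)
def axAtomic : Lmso.Sentence := ∀' (∼(isBot' 0) ⟹ ∃' (at' 1 ⊓ sub' 1 0))
def axIrrefl : Lmso.Sentence := ∀' (at' 0 ⟹ ∼(exle' 0 0))
def axTransAt : Lmso.Sentence :=
  ∀' ∀' ∀' ((at' 0 ⊓ at' 1 ⊓ at' 2 ⊓ exle' 0 1 ⊓ exle' 1 2) ⟹ exle' 0 2)
def axTrich : Lmso.Sentence :=
  ∀' ∀' ((at' 0 ⊓ at' 1) ⟹ (exle' 0 1 ⊔ eq' 0 1 ⊔ exle' 1 0))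
def axExleDef : Lmso.Sentence :=
  ∀' ∀' (exle' 0 1 ⇔ ∃' ∃' (at' 2 ⊓ at' 3 ⊓ sub' 2 0 ⊓ sub' 3 1 ⊓ exle' 2 3))

/-- The comprehension axiom for a formula `η(x; Y₁,…,Yₙ)` (with `x` the last variable):
`∀ Ȳ ∃ X ∀ x (At x → (x ⊆ X ↔ η(x; Ȳ)))`. -/
def compAx {n : ℕ} (η : BF (n + 1)) : Lmso.Sentence :=
  BoundedFormula.alls (∃' ∀' (at' (Fin.last (n + 1)) ⟹
    (sub' (Fin.last (n + 1)) ((Fin.last n).castSucc) ⇔ η.liftAt 1 n)))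

/-- The base theory `T_base`: an atomic Boolean algebra under `⊆` with bottom `⊥`, `At`
holding exactly of the atoms, `≤ᴱ` linearly ordering the atoms and determined by its
restriction to the atoms, together with the comprehension scheme. -/
def Tbase : Lmso.Theory :=
  {axRefl, axAntisymm, axTrans, axBotLe, axTop, axMeet, axJoin, axCompl, axDistrib,
    axAt, axAtomic, axIrrefl, axTransAt, axTrich, axExleDef} ∪
  ⋃ n : ℕ, Set.range (compAx (n := n))

/-! ### The theory `T_MSO(Fin)` -/

/-- `i` is the `≤ᴱ`-least atom. -/
def isLeastAtom {n : ℕ} (i : Fin n) : BF n :=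
  at' i ⊓ ∀' (at' (Fin.last n) ⟹ ∼(exle' (Fin.last n) i.castSucc))

/-- `i` is the `≤ᴱ`-greatest atom. -/
def isGreatestAtom {n : ℕ} (i : Fin n) : BF n :=
  at' i ⊓ ∀' (at' (Fin.last n) ⟹ ∼(exle' i.castSucc (Fin.last n)))

/-- `j` is the immediate `≤ᴱ`-successor of the atom `i`. -/
def isSuccOf {n : ℕ} (j i : Fin n) : BF n :=
  at' i ⊓ at' j ⊓ exle' i j ⊓
    ∀' ((at' (Fin.last n) ⊓ exle' i.castSucc (Fin.last n)) ⟹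
      (eq' (Fin.last n) j.castSucc ⊔ exle' j.castSucc (Fin.last n)))

def axLeastAtom : Lmso.Sentence := (∃' at' 0) ⟹ ∃' isLeastAtom 0
def axGreatestAtom : Lmso.Sentence := (∃' at' 0) ⟹ ∃' isGreatestAtom 0
def axSucc : Lmso.Sentence :=
  ∀' ((at' 0 ⊓ ∃' (at' 1 ⊓ exle' 0 1)) ⟹ ∃' isSuccOf 1 0)
def axPred : Lmso.Sentence :=
  ∀' ((at' 0 ⊓ ∃' (at' 1 ⊓ exle' 1 0)) ⟹ ∃' isSuccOf 0 1)
def axLeastIn : Lmso.Sentence :=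
  ∀' (∼(isBot' 0) ⟹ ∃' (at' 1 ⊓ sub' 1 0 ⊓ ∀' ((at' 2 ⊓ sub' 2 0) ⟹ ∼(exle' 2 1))))

/-- The theory `T_MSO(Fin)`: `T_base` together with axioms saying that the ordering of the
atoms is discrete with endpoints, and every non-bottom element contains a least atom. -/
def TMSOFin : Lmso.Theory :=
  Tbase ∪ {axLeastAtom, axGreatestAtom, axSucc, axPred, axLeastIn}

/-! ### Quantifier rank, unnested formulas, and `≈ₖ` -/

/-- Quantifier rank of a bounded formula. -/
def qr : ∀ {n : ℕ}, BF n → ℕ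
  | _, BoundedFormula.falsum => 0
  | _, BoundedFormula.equal _ _ => 0
  | _, BoundedFormula.rel _ _ => 0
  | _, BoundedFormula.imp f g => max (qr f) (qr g)
  | _, BoundedFormula.all f => qr f + 1

/-- A formula is unnested if every atomic subformula is of one of the forms
`x = y`, `c = y`, or `R x̄` with the `xᵢ`, `y` variables (Hodges). -/
def IsUnnested : ∀ {n : ℕ}, BF n → Prop
  | _, BoundedFormula.falsum => True
  | _, BoundedFormula.equal s t =>
      (∃ i j, s = Term.var i ∧ t = Term.var j) ∨
      (∃ (c : Lmso.Constants) (j : _), s = Constants.term c ∧ t = Term.var j)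
  | _, BoundedFormula.rel _ ts => ∀ i, ∃ j, ts i = Term.var j
  | _, BoundedFormula.imp f g => IsUnnested f ∧ IsUnnested g
  | _, BoundedFormula.all f => IsUnnested f

/-- `M ≈ₖ N` : `M` and `N` satisfy the same unnested `L_⊗`-sentences of quantifier
rank at most `k`. -/
def EquivK (k : ℕ) (M N : Type*) [Lmso.Structure M] [Lmso.Structure N] : Prop :=
  ∀ φ : Lmso.Sentence, IsUnnested φ → qr φ ≤ k → (M ⊨ φ ↔ N ⊨ φ)

/-! ### The sentences `ρ_{d,h}`, `ψ_{>n}`, `ψ_{=n}` -/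

/-- The index (in `Fin d`) of `A_h` among `A₁, …, A_d`, identifying `h = 0` with `h = d`. -/
def aIdx (d h : ℕ) (hd : 0 < d) : Fin d := ⟨(h + d - 1) % d, Nat.mod_lt _ hd⟩

/-- The cyclic successor on the indices `{1, …, d}`. -/
def cyc {d : ℕ} (j : Fin d) : Fin d := ⟨((j : ℕ) + 1) % d, Nat.mod_lt _ j.pos⟩

/-- The sentence `ρ_{d,h}`: there is a partition of the atoms into `d` non-bottom elements
`A₁, …, A_d` such that the least atom is in `A₁`, the immediate successor of an atom lying in
`A_j` lies in `A_{j+1}` (cyclically), and the greatest atom is in `A_h`. -/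
def rho (d h : ℕ) : Lmso.Sentence :=
  if hd : 0 < d then
    BoundedFormula.exs (n := d) (
      -- each `A_i` is non-bottom
      bigAnd ((List.finRange d).map fun i => ∼(isBot' i)) ⊓
      -- every atom lies in some `A_i`
      (∀' (at' (Fin.last d) ⟹
        bigOr ((List.finRange d).map fun i => sub' (Fin.last d) i.castSucc))) ⊓
      -- the `A_i` are pairwise disjoint on atoms
      bigAnd ((List.finRange d).flatMap fun i => (List.finRange d).filterMap fun j =>
        if i.val < j.val then
          some (∀' (at' (Fin.last d) ⟹
            ∼(sub' (Fin.last d) i.castSucc ⊓ sub' (Fin.last d) j.castSucc)))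
        else none) ⊓
      -- the least atom lies in `A₁`
      (∀' (isLeastAtom (Fin.last d) ⟹ sub' (Fin.last d) ((aIdx d 1 hd).castSucc))) ⊓
      -- immediate successors move cyclically through the `A_j`
      bigAnd ((List.finRange d).map fun j =>
        ∀' ∀' ((sub' ((Fin.last d).castSucc) (j.castSucc.castSucc) ⊓
            isSuccOf (Fin.last (d + 1)) ((Fin.last d).castSucc)) ⟹
          sub' (Fin.last (d + 1)) ((cyc j).castSucc.castSucc))) ⊓
      -- the greatest atom lies in `A_h`
      (∀' (isGreatestAtom (Fin.last d) ⟹ sub' (Fin.last d) ((aIdx d h hd).castSucc))))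
  else ⊥

/-- The list of formulas `xᵢ ≠ xⱼ` for `i < j < n`. -/
def distinctPairs (n : ℕ) : List (BF n) :=
  (List.finRange n).flatMap fun i => (List.finRange n).filterMap fun j =>
    if i.val < j.val then some (∼(eq' i j)) else none

/-- `ψ_{>n}` : there exist at least `n + 1` distinct atoms. -/
def psiGt (n : ℕ) : Lmso.Sentence :=
  BoundedFormula.exs (n := n + 1)
    (bigAnd ((List.finRange (n + 1)).map fun i => at' i) ⊓ bigAnd (distinctPairs (n + 1)))

/-- `ψ_{=n}` : there exist exactly `n` distinct atoms. -/
def psiEq (n : ℕ) : Lmso.Sentence :=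
  BoundedFormula.exs (n := n)
    (bigAnd ((List.finRange n).map fun i => at' i) ⊓ bigAnd (distinctPairs n) ⊓
      ∀' (at' (Fin.last n) ⟹ bigOr ((List.finRange n).map fun i => eq' (Fin.last n) i.castSucc)))

/-! ### Residue functions and the theories `T_r̃` -/

/-- A residue function `ℙ × ℕ_{>0} → ℕ` (conditions imposed only at primes `p` and `j ≥ 1`):
`r(p,j) < p^j` and `r(p,j+1) ≡ r(p,j) [MOD p^j]`. -/
def IsResidueFunction (r : ℕ → ℕ → ℕ) : Prop :=
  ∀ p j : ℕ, p.Prime → 1 ≤ j → r p j < p ^ j ∧ r p (j + 1) ≡ r p j [MOD p ^ j]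

/-- A function `ℕ_{>1} → ℕ` is a residue function if it arises from a residue function
`ℙ × ℕ_{>0} → ℕ` as in the paper (conditions imposed only for `d > 1`). -/
def IsResidueFunctionTilde (rt : ℕ → ℕ) : Prop :=
  ∃ r : ℕ → ℕ → ℕ, IsResidueFunction r ∧
    ∀ d : ℕ, 1 < d → rt d < d ∧
      ∀ p j : ℕ, p.Prime → 1 ≤ j → p ^ j ∣ d → rt d ≡ r p j [MOD p ^ j]

/-- The theory `T_r̃ = T_MSO(Fin) ∪ {ψ_{>n} : n ∈ ℕ} ∪ {ρ_{d,r̃(d)} : d > 1}`. -/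
def Trt (rt : ℕ → ℕ) : Lmso.Theory :=
  TMSOFin ∪ Set.range psiGt ∪ {σ : Lmso.Sentence | ∃ d : ℕ, 1 < d ∧ σ = rho d (rt d)}

/-! ### Relativization and the sum of sentences -/

/-- Relativization of a formula to the elements `⊆ v`:
each quantifier `∀ Z (…)` becomes `∀ Z (Z ⊆ v → …)`. -/
def relv : ∀ {n : ℕ}, BF n → Fin n → BF n
  | _, BoundedFormula.falsum, _ => BoundedFormula.falsum
  | _, BoundedFormula.equal s t, _ => BoundedFormula.equal s t
  | _, BoundedFormula.rel r ts, _ => BoundedFormula.rel r ts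
  | _, BoundedFormula.imp f g, v => (relv f v).imp (relv g v)
  | n, BoundedFormula.all f, v =>
      BoundedFormula.all (sub' (Fin.last n) v.castSucc ⟹ relv f v.castSucc)

/-- `i` is downward closed with respect to the `≤ᴱ`-ordering of the atoms. -/
def dwcl' {n : ℕ} (i : Fin n) : BF n :=
  ∀' ∀' ((at' ((Fin.last n).castSucc) ⊓ at' (Fin.last (n + 1)) ⊓
      sub' ((Fin.last n).castSucc) (i.castSucc.castSucc) ⊓
      exle' (Fin.last (n + 1)) ((Fin.last n).castSucc)) ⟹
    sub' (Fin.last (n + 1)) (i.castSucc.castSucc))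

/-- The sentence `φ + ψ` : `∃ X (X downward closed ∧ φ^X ∧ ψ^(Xᶜ))`
(with the complement `Xᶜ` introduced by an existential quantifier). -/
def plusSent (φ ψ : Lmso.Sentence) : Lmso.Sentence :=
  ∃' ∃' (dwcl' (0 : Fin 2) ⊓ isComplOf (1 : Fin 2) (0 : Fin 2) ⊓
    relv (φ.liftAt 2 0) (0 : Fin 2) ⊓ relv (ψ.liftAt 2 0) (1 : Fin 2))

/-! ### `FSpec` and ultimate periodicity -/

/-- `FSpec φ` : the set of `n ∈ ℕ` such that `MSO(n) ⊨ φ`. -/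
def FSpec (φ : Lmso.Sentence) : Set ℕ := {n : ℕ | MSOn n ⊨ φ}

/-- A set of naturals is ultimately periodic. -/
def UltPeriodic (S : Set ℕ) : Prop :=
  ∃ N d : ℕ, 0 < d ∧ ∀ n : ℕ, N < n → (n ∈ S ↔ n + d ∈ S)

/-! ### The language `L_MO = {⊆, <}` -/

/-- The language `L_MO` with two binary relations: `⊆` (encoded `true`) and `<`
(encoded `false`). -/
def Lmo : Language where
  Functions := fun _ => Empty
  Relations := fun n => match n with | 2 => Bool | _ => Empty

/-- The monadic second order version `MSO(α)` of a linear order `α` as an `L_MO`-structure: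
`⊆` is inclusion and `<` is the ordering of `α` on singletons. -/
instance moStructure (α : Type*) [LinearOrder α] : Lmo.Structure (Set α) where
  funMap := fun f _ => f.elim
  RelMap := fun {n} r v => match n, r with
    | 2, true => v 0 ⊆ v 1
    | 2, false => ∃ a b : α, v 0 = {a} ∧ v 1 = {b} ∧ a < b

section Semantics

variable {M : Type} [Lmso.Structure M]

/-- `k` is the meet of `i` and `j`, semantically. -/
def IsMeetE (k i j : M) : Prop :=
  (subE k i ∧ subE k j) ∧ ∀ z, subE z i ∧ subE z j → subE z k

/-- `k` is the join of `i` and `j`, semantically. -/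
def IsJoinE (k i j : M) : Prop :=
  (subE i k ∧ subE j k) ∧ ∀ z, subE i z ∧ subE j z → subE k z

/-- `j` is a complement of `i`, semantically. -/
def IsComplE (j i : M) : Prop :=
  (∀ z, subE z j ∧ subE z i → z = botE M) ∧ ∀ z, subE j z ∧ subE i z → ∀ w, subE w z

/-- `i` is the least atom, semantically. -/
def IsLeastAtomE (i : M) : Prop := atE i ∧ ∀ z, atE z → ¬ exleE z i

/-- `i` is the greatest atom, semantically. -/
def IsGreatestAtomE (i : M) : Prop := atE i ∧ ∀ z, atE z → ¬ exleE i z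

/-- `j` is the immediate successor of the atom `i`, semantically. -/
def IsSuccE (j i : M) : Prop :=
  ((atE i ∧ atE j) ∧ exleE i j) ∧ ∀ z, atE z ∧ exleE i z → z = j ∨ exleE j z

variable {n : ℕ} {v : Empty → M} {xs : Fin n → M}

theorem realize_tv (i : Fin n) : (tv i).realize (Sum.elim v xs) = xs i := rfl

theorem realize_tb : (tb : Lmso.Term (Empty ⊕ Fin n)).realize (Sum.elim v xs) = botE M := by
  simp only [tb, Constants.term, Term.realize, botE]
  congr 1
  exact Subsingleton.elim _ _

theorem realize_sub' (i j : Fin n) : (sub' i j).Realize v xs ↔ subE (xs i) (xs j) := by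
  simp [sub', BoundedFormula.realize_rel₂, realize_tv, subE]

theorem realize_exle' (i j : Fin n) : (exle' i j).Realize v xs ↔ exleE (xs i) (xs j) := by
  simp [exle', BoundedFormula.realize_rel₂, realize_tv, exleE]

theorem realize_at' (i : Fin n) : (at' i).Realize v xs ↔ atE (xs i) := by
  simp [at', BoundedFormula.realize_rel₁, realize_tv, atE]

theorem realize_eq' (i j : Fin n) : (eq' i j).Realize v xs ↔ xs i = xs j := by
  simp [eq', realize_tv]

theorem realize_isBot' (i : Fin n) : (isBot' i).Realize v xs ↔ xs i = botE M := by
  simp [isBot', realize_tv, realize_tb]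

theorem realize_botSub' (i : Fin n) : (botSub' i).Realize v xs ↔ subE (botE M) (xs i) := by
  simp [botSub', BoundedFormula.realize_rel₂, realize_tv, realize_tb, subE]

theorem realize_isMeet (k i j : Fin n) :
    (isMeet k i j).Realize v xs ↔ IsMeetE (xs k) (xs i) (xs j) := by
  simp [isMeet, IsMeetE, realize_sub']

theorem realize_isJoin (k i j : Fin n) :
    (isJoin k i j).Realize v xs ↔ IsJoinE (xs k) (xs i) (xs j) := by
  simp [isJoin, IsJoinE, realize_sub']

theorem realize_isComplOf (j i : Fin n) :
    (isComplOf j i).Realize v xs ↔ IsComplE (xs i) (xs j) := by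
  simp only [isComplOf, meetIsBot, joinIsTop, IsComplE, realize_sub', realize_isBot',
    BoundedFormula.realize_inf, BoundedFormula.realize_all, BoundedFormula.realize_imp,
    Fin.snoc_castSucc, Fin.snoc_last]

theorem realize_isAtomDef (i : Fin n) : (isAtomDef i).Realize v xs ↔
    xs i ≠ botE M ∧ ∀ z, subE z (xs i) → z = botE M ∨ z = xs i := by
  simp [isAtomDef, realize_sub', realize_isBot', realize_eq']

theorem realize_isLeastAtom (i : Fin n) :
    (isLeastAtom i).Realize v xs ↔ IsLeastAtomE (xs i) := by
  simp [isLeastAtom, IsLeastAtomE, realize_at', realize_exle']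

theorem realize_isGreatestAtom (i : Fin n) :
    (isGreatestAtom i).Realize v xs ↔ IsGreatestAtomE (xs i) := by
  simp [isGreatestAtom, IsGreatestAtomE, realize_at', realize_exle']

theorem realize_isSuccOf (j i : Fin n) :
    (isSuccOf j i).Realize v xs ↔ IsSuccE (xs j) (xs i) := by
  simp [isSuccOf, IsSuccE, realize_at', realize_exle', realize_eq']

theorem realize_compAx (η : BF (n + 1)) : M ⊨ compAx η ↔
    ∀ Y : Fin n → M, ∃ X, ∀ x, atE x → (subE x X ↔ η.Realize default (Fin.snoc Y x)) := by
  rw [compAx, Sentence.Realize, BoundedFormula.realize_alls]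
  refine forall_congr' fun Y => ?_
  simp only [BoundedFormula.realize_ex, BoundedFormula.realize_all, BoundedFormula.realize_imp,
    BoundedFormula.realize_iff, realize_at', realize_sub', Fin.snoc_last, Fin.snoc_castSucc]
  refine exists_congr fun X => forall_congr' fun x => imp_congr_right fun _ => iff_congr Iff.rfl ?_
  rw [BoundedFormula.realize_liftAt_one (by omega)]
  apply iff_of_eq
  congr 1
  funext i
  refine Fin.lastCases ?_ (fun i => ?_) i
  · have : (Fin.last n).succ = Fin.last (n + 1) := rfl
    simp [this]
  · simp [Fin.snoc_castSucc]

variable (M) in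
/-- The models of `T_MSO(Fin)`, described semantically. -/
structure FinModel : Prop where
  refl (a : M) : subE a a
  antisymm (a b : M) : subE a b ∧ subE b a → a = b
  trans (a b c : M) : subE a b ∧ subE b c → subE a c
  bot_le (a : M) : subE (botE M) a
  top : ∃ a : M, ∀ b, subE b a
  meet (a b : M) : ∃ c, IsMeetE c a b
  join (a b : M) : ∃ c, IsJoinE c a b
  compl (a : M) : ∃ b, IsComplE a b
  distrib (a b c d e f g h : M) :
    (((IsMeetE d a b ∧ IsMeetE e a c) ∧ IsJoinE f b c) ∧ IsMeetE g a f) ∧ IsJoinE h d e →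
      subE g h
  at_iff (a : M) : atE a ↔ a ≠ botE M ∧ ∀ z, subE z a → z = botE M ∨ z = a
  atomic (a : M) : a ≠ botE M → ∃ b, atE b ∧ subE b a
  irrefl (a : M) : atE a → ¬ exleE a a
  trans_at (a b c : M) : (((atE a ∧ atE b) ∧ atE c) ∧ exleE a b) ∧ exleE b c → exleE a c
  trich (a b : M) : atE a ∧ atE b → (exleE a b ∨ a = b) ∨ exleE b a
  exle_iff (a b : M) : exleE a b ↔
    ∃ c d, (((atE c ∧ atE d) ∧ subE c a) ∧ subE d b) ∧ exleE c d
  comp {n : ℕ} (η : BF (n + 1)) (Y : Fin n → M) :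
    ∃ X, ∀ x, atE x → (subE x X ↔ η.Realize default (Fin.snoc Y x))
  least_atom : (∃ a : M, atE a) → ∃ a : M, IsLeastAtomE a
  greatest_atom : (∃ a : M, atE a) → ∃ a : M, IsGreatestAtomE a
  succ (a : M) : (atE a ∧ ∃ b, atE b ∧ exleE a b) → ∃ b, IsSuccE b a
  pred (a : M) : (atE a ∧ ∃ b, atE b ∧ exleE b a) → ∃ b, IsSuccE a b
  least_in (a : M) : a ≠ botE M →
    ∃ b, (atE b ∧ subE b a) ∧ ∀ c, atE c ∧ subE c a → ¬ exleE c b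

theorem finModel_iff : M ⊨ TMSOFin ↔ FinModel M := by
  have key : M ⊨ TMSOFin ↔
      ((M ⊨ axRefl ∧ M ⊨ axAntisymm ∧ M ⊨ axTrans ∧ M ⊨ axBotLe ∧ M ⊨ axTop ∧ M ⊨ axMeet ∧
        M ⊨ axJoin ∧ M ⊨ axCompl ∧ M ⊨ axDistrib ∧ M ⊨ axAt ∧ M ⊨ axAtomic ∧ M ⊨ axIrrefl ∧
        M ⊨ axTransAt ∧ M ⊨ axTrich ∧ M ⊨ axExleDef) ∧
        ∀ (n : ℕ) (η : BF (n + 1)), M ⊨ compAx η) ∧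
      M ⊨ axLeastAtom ∧ M ⊨ axGreatestAtom ∧ M ⊨ axSucc ∧ M ⊨ axPred ∧ M ⊨ axLeastIn := by
    simp only [TMSOFin, Tbase, Theory.model_iff, Set.mem_union, or_imp, forall_and,
      Set.mem_insert_iff, Set.mem_singleton_iff, forall_eq, Set.mem_iUnion, Set.mem_range,
      forall_exists_index]
    refine and_congr (and_congr Iff.rfl ?_) Iff.rfl
    exact ⟨fun h n η => h _ n η rfl, fun h _ n η e => e ▸ h n η⟩
  rw [key]
  simp only [realize_compAx]
  simp only [Sentence.Realize, Formula.Realize, axRefl, axAntisymm, axTrans, axBotLe, axTop,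
    axMeet, axJoin, axCompl, axDistrib, axAt, axAtomic, axIrrefl, axTransAt, axTrich, axExleDef,
    axLeastAtom, axGreatestAtom, axSucc, axPred, axLeastIn,
    BoundedFormula.realize_all, BoundedFormula.realize_ex, BoundedFormula.realize_imp,
    BoundedFormula.realize_inf, BoundedFormula.realize_sup, BoundedFormula.realize_iff,
    BoundedFormula.realize_not,
    realize_sub', realize_exle', realize_at', realize_eq', realize_isBot', realize_botSub',
    realize_isMeet, realize_isJoin, realize_isComplOf, realize_isAtomDef, realize_isLeastAtom,
    realize_isGreatestAtom, realize_isSuccOf]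
  constructor
  · rintro ⟨⟨⟨h1, h2, h3, h4, h5, h6, h7, h8, h9, h10, h11, h12, h13, h14, h15⟩, h16⟩,
      h17, h18, h19, h20, h21⟩
    exact ⟨h1, h2, h3, h4, h5, h6, h7, h8, h9, h10, h11, h12, h13, h14, h15, @h16,
      h17, h18, h19, h20, h21⟩
  · rintro ⟨h1, h2, h3, h4, h5, h6, h7, h8, h9, h10, h11, h12, h13, h14, h15, h16,
      h17, h18, h19, h20, h21⟩
    exact ⟨⟨⟨h1, h2, h3, h4, h5, h6, h7, h8, h9, h10, h11, h12, h13, h14, h15⟩, @h16⟩,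
      h17, h18, h19, h20, h21⟩

end Semantics

section Product

variable {M N : Type} [Lmso.Structure M] [Lmso.Structure N]

namespace FinModel

theorem eq_bot (hM : FinModel M) {a : M} (h : subE a (botE M)) : a = botE M :=
  hM.antisymm _ _ ⟨h, hM.bot_le a⟩

theorem ne_bot (hM : FinModel M) {a : M} (h : atE a) : a ≠ botE M := ((hM.at_iff a).1 h).1

theorem not_atE_bot (hM : FinModel M) : ¬ atE (botE M) := fun h => hM.ne_bot h rfl

theorem not_exleE_bot_left (hM : FinModel M) (a : M) : ¬ exleE (botE M) a := by
  rw [hM.exle_iff]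
  rintro ⟨c, d, ⟨⟨⟨hc, -⟩, h⟩, -⟩, -⟩
  exact hM.ne_bot hc (hM.eq_bot h)

theorem not_exleE_bot_right (hM : FinModel M) (a : M) : ¬ exleE a (botE M) := by
  rw [hM.exle_iff]
  rintro ⟨c, d, ⟨⟨⟨-, hd⟩, -⟩, h⟩, -⟩
  exact hM.ne_bot hd (hM.eq_bot h)

end FinModel

theorem botE_prod : botE (M × N) = (botE M, botE N) := rfl

theorem subE_prod {p q : M × N} : subE p q ↔ subE p.1 q.1 ∧ subE p.2 q.2 := Iff.rfl

theorem exleE_prod {p q : M × N} : exleE p q ↔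
    (p.1 ≠ botE M ∧ q.2 ≠ botE N) ∨ exleE p.1 q.1 ∨ exleE p.2 q.2 := Iff.rfl

theorem atE_prod_def {p : M × N} : atE p ↔ p ≠ (botE M, botE N) ∧
    ∀ q : M × N, subE q.1 p.1 → subE q.2 p.2 → q = (botE M, botE N) ∨ q = p := Iff.rfl

theorem atE_prod (hM : FinModel M) (hN : FinModel N) {p : M × N} :
    atE p ↔ (atE p.1 ∧ p.2 = botE N) ∨ (p.1 = botE M ∧ atE p.2) := by
  obtain ⟨a, b⟩ := p
  rw [atE_prod_def, hM.at_iff, hN.at_iff]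
  dsimp only
  constructor
  · rintro ⟨h, hq⟩
    by_cases ha : a = botE M
    · subst ha
      refine Or.inr ⟨rfl, fun hb => h (by rw [hb]), fun z hz => ?_⟩
      simpa using hq (botE M, z) (hM.refl _) hz
    · have hb : b = botE N := by
        have := hq (a, botE N) (hM.refl _) (hN.bot_le _)
        simp only [Prod.mk.injEq, ha, false_and, true_and, false_or] at this
        exact this.symm
      subst hb
      refine Or.inl ⟨⟨ha, fun z hz => ?_⟩, rfl⟩
      simpa using hq (z, botE N) hz (hN.refl _)
  · rintro (⟨⟨ha, h⟩, rfl⟩ | ⟨rfl, hb, h⟩)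
    · refine ⟨by simpa using ha, fun ⟨q, r⟩ hq hr => ?_⟩
      obtain rfl := hN.eq_bot hr
      simpa using h q hq
    · refine ⟨by simpa using hb, fun ⟨q, r⟩ hq hr => ?_⟩
      obtain rfl := hM.eq_bot hq
      simpa using h r hr

theorem forall_atE_prod (hM : FinModel M) (hN : FinModel N) {Q : M × N → Prop} :
    (∀ p, atE p → Q p) ↔
      (∀ a, atE a → Q (a, botE N)) ∧ ∀ b, atE b → Q (botE M, b) := by
  simp only [atE_prod hM hN]
  constructor
  · exact fun h => ⟨fun a ha => h _ (Or.inl ⟨ha, rfl⟩), fun b hb => h _ (Or.inr ⟨rfl, hb⟩)⟩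
  · rintro ⟨h1, h2⟩ ⟨a, b⟩ (⟨ha, rfl⟩ | ⟨rfl, hb⟩)
    exacts [h1 a ha, h2 b hb]

theorem exists_atE_prod (hM : FinModel M) (hN : FinModel N) {Q : M × N → Prop} :
    (∃ p, atE p ∧ Q p) ↔
      (∃ a, atE a ∧ Q (a, botE N)) ∨ ∃ b, atE b ∧ Q (botE M, b) := by
  rw [← not_iff_not]
  simpa only [not_exists, not_and, not_or] using forall_atE_prod hM hN (Q := fun p => ¬ Q p)

theorem isMeetE_prod (hM : FinModel M) (hN : FinModel N) {k i j : M × N} :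
    IsMeetE k i j ↔ IsMeetE k.1 i.1 j.1 ∧ IsMeetE k.2 i.2 j.2 := by
  simp only [IsMeetE, subE_prod]
  constructor
  · rintro ⟨⟨⟨h1, h2⟩, h3, h4⟩, h⟩
    exact ⟨⟨⟨h1, h3⟩, fun z hz =>
        (h (z, botE N) ⟨⟨hz.1, hN.bot_le _⟩, hz.2, hN.bot_le _⟩).1⟩, ⟨h2, h4⟩, fun z hz =>
        (h (botE M, z) ⟨⟨hM.bot_le _, hz.1⟩, hM.bot_le _, hz.2⟩).2⟩
  · rintro ⟨⟨⟨h1, h3⟩, h⟩, ⟨h2, h4⟩, h'⟩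
    exact ⟨⟨⟨h1, h2⟩, h3, h4⟩, fun z hz => ⟨h _ ⟨hz.1.1, hz.2.1⟩, h' _ ⟨hz.1.2, hz.2.2⟩⟩⟩

theorem isJoinE_prod (hM : FinModel M) (hN : FinModel N) {k i j : M × N} :
    IsJoinE k i j ↔ IsJoinE k.1 i.1 j.1 ∧ IsJoinE k.2 i.2 j.2 := by
  obtain ⟨s, hs⟩ := hM.top
  obtain ⟨t, ht⟩ := hN.top
  simp only [IsJoinE, subE_prod]
  constructor
  · rintro ⟨⟨⟨h1, h2⟩, h3, h4⟩, h⟩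
    exact ⟨⟨⟨h1, h3⟩, fun z hz => (h (z, t) ⟨⟨hz.1, ht _⟩, hz.2, ht _⟩).1⟩, ⟨h2, h4⟩,
      fun z hz => (h (s, z) ⟨⟨hs _, hz.1⟩, hs _, hz.2⟩).2⟩
  · rintro ⟨⟨⟨h1, h3⟩, h⟩, ⟨h2, h4⟩, h'⟩
    exact ⟨⟨⟨h1, h2⟩, h3, h4⟩, fun z hz => ⟨h _ ⟨hz.1.1, hz.2.1⟩, h' _ ⟨hz.1.2, hz.2.2⟩⟩⟩

theorem isComplE_prod {j i : M × N} (h1 : IsComplE j.1 i.1) (h2 : IsComplE j.2 i.2) :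
    IsComplE j i := by
  simp only [IsComplE, subE_prod]
  exact ⟨fun z hz => Prod.ext (h1.1 _ ⟨hz.1.1, hz.2.1⟩) (h2.1 _ ⟨hz.1.2, hz.2.2⟩),
    fun z hz w => ⟨h1.2 _ ⟨hz.1.1, hz.2.1⟩ _, h2.2 _ ⟨hz.1.2, hz.2.2⟩ _⟩⟩

end Product

section FefermanVaught

/-- A property of pairs of tuples from two models is decomposable if it is uniformly equivalent
to a finite disjunction of conjunctions of a formula about the first tuple and a formula about
the second. -/
def Decomposable {n : ℕ} (P : ∀ (M N : Type) [Lmso.Structure M] [Lmso.Structure N],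
    (Fin n → M) → (Fin n → N) → Prop) : Prop :=
  ∃ l : List (BF n × BF n), ∀ (M N : Type) [Lmso.Structure M] [Lmso.Structure N],
    FinModel M → FinModel N → ∀ (xs : Fin n → M) (ys : Fin n → N),
      P M N xs ys ↔ ∃ p ∈ l, p.1.Realize default xs ∧ p.2.Realize default ys

variable {n : ℕ} {P Q : ∀ (M N : Type) [Lmso.Structure M] [Lmso.Structure N],
    (Fin n → M) → (Fin n → N) → Prop}

namespace Decomposable

theorem rect (θ χ : BF n) :
    Decomposable fun _ _ _ _ xs ys => θ.Realize default xs ∧ χ.Realize default ys :=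
  ⟨[(θ, χ)], fun M N _ _ _ _ xs ys => by simp⟩

theorem congr (h : ∀ (M N : Type) [Lmso.Structure M] [Lmso.Structure N],
    FinModel M → FinModel N → ∀ (xs : Fin n → M) (ys : Fin n → N),
      P M N xs ys ↔ Q M N xs ys) (hQ : Decomposable Q) : Decomposable P := by
  obtain ⟨l, hl⟩ := hQ
  exact ⟨l, fun M N _ _ hM hN xs ys => (h M N hM hN xs ys).trans (hl M N hM hN xs ys)⟩

theorem false : Decomposable (n := n) fun _ _ _ _ _ _ => False :=
  ⟨[], fun M N _ _ _ _ xs ys => by simp⟩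

theorem or (hP : Decomposable P) (hQ : Decomposable Q) :
    Decomposable fun M N _ _ xs ys => P M N xs ys ∨ Q M N xs ys := by
  obtain ⟨l, hl⟩ := hP
  obtain ⟨l', hl'⟩ := hQ
  refine ⟨l ++ l', fun M N _ _ hM hN xs ys => ?_⟩
  beta_reduce
  rw [hl M N hM hN, hl' M N hM hN]
  simp only [List.mem_append, or_and_right, exists_or]

theorem and (hP : Decomposable P) (hQ : Decomposable Q) :
    Decomposable fun M N _ _ xs ys => P M N xs ys ∧ Q M N xs ys := by
  obtain ⟨l, hl⟩ := hP
  obtain ⟨l', hl'⟩ := hQ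
  refine ⟨(l ×ˢ l').map fun r => (r.1.1 ⊓ r.2.1, r.1.2 ⊓ r.2.2), fun M N _ _ hM hN xs ys => ?_⟩
  beta_reduce
  rw [hl M N hM hN, hl' M N hM hN]
  simp only [List.mem_map, exists_exists_and_eq_and, BoundedFormula.realize_inf]
  constructor
  · rintro ⟨⟨p, hp, hp1, hp2⟩, q, hq, hq1, hq2⟩
    exact ⟨(p, q), List.mem_product.2 ⟨hp, hq⟩, ⟨hp1, hq1⟩, hp2, hq2⟩
  · rintro ⟨⟨p, q⟩, h, ⟨hp1, hq1⟩, hp2, hq2⟩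
    obtain ⟨hp, hq⟩ := List.mem_product.1 h
    exact ⟨⟨p, hp, hp1, hp2⟩, q, hq, hq1, hq2⟩

theorem not (hP : Decomposable P) : Decomposable fun M N _ _ xs ys => ¬ P M N xs ys := by
  obtain ⟨l, hl⟩ := hP
  refine congr (fun M N _ _ hM hN xs ys => not_congr (hl M N hM hN xs ys)) ?_
  clear hl
  induction l with
  | nil => exact congr (fun M N _ _ _ _ xs ys => by simp) (rect ⊤ ⊤)
  | cons p l ih =>
    refine congr (fun M N _ _ _ _ xs ys => ?_) (((rect (∼p.1) ⊤).or (rect ⊤ (∼p.2))).and ih)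
    simp only [List.mem_cons, exists_eq_or_imp, not_or, not_and_or, BoundedFormula.realize_not,
      BoundedFormula.realize_top, and_true, true_and]

theorem ex {P : ∀ (M N : Type) [Lmso.Structure M] [Lmso.Structure N],
    (Fin (n + 1) → M) → (Fin (n + 1) → N) → Prop} (hP : Decomposable P) :
    Decomposable fun M N _ _ xs ys =>
      ∃ (a : M) (b : N), P M N (Fin.snoc xs a) (Fin.snoc ys b) := by
  obtain ⟨l, hl⟩ := hP
  refine ⟨l.map fun p => (∃' p.1, ∃' p.2), fun M N _ _ hM hN xs ys => ?_⟩
  simp only [hl M N hM hN, List.mem_map, exists_exists_and_eq_and, BoundedFormula.realize_ex]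
  constructor
  · rintro ⟨a, b, p, hp, h1, h2⟩
    exact ⟨p, hp, ⟨a, h1⟩, b, h2⟩
  · rintro ⟨p, hp, ⟨a, h1⟩, b, h2⟩
    exact ⟨a, b, p, hp, h1, h2⟩

end Decomposable

theorem snoc_prod {M N : Type} (xs : Fin n → M) (ys : Fin n → N) (p : M × N) :
    (Fin.snoc (fun i => (xs i, ys i)) p : Fin (n + 1) → M × N) =
      fun i => ((Fin.snoc xs p.1 : Fin (n + 1) → M) i, (Fin.snoc ys p.2 : Fin (n + 1) → N) i) := by
  funext i
  refine Fin.lastCases ?_ (fun i => ?_) i <;> simp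

variable {M N : Type} [Lmso.Structure M] [Lmso.Structure N]

theorem realize_term_prod (t : Lmso.Term (Empty ⊕ Fin n)) (xs : Fin n → M) (ys : Fin n → N) :
    t.realize (Sum.elim (default : Empty → M × N) fun i => (xs i, ys i)) =
      (t.realize (Sum.elim default xs), t.realize (Sum.elim default ys)) := by
  cases t with
  | var i =>
    rcases i with i | i
    · exact i.elim
    · rfl
  | @func k f ts =>
    match k, f with
    | 0, f =>
      have : Subsingleton (Lmso.Functions 0) := inferInstanceAs (Subsingleton Unit)
      have h (K : Type) [Lmso.Structure K] (w : Fin 0 → K) :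
          Structure.funMap (L := Lmso) f w = botE K := by
        rw [Subsingleton.elim w ![], Subsingleton.elim f botC]; rfl
      simp only [Term.realize]
      rw [h M, h N, h (M × N)]
      rfl

/-- The Feferman–Vaught theorem for `⊗`. -/
theorem decomposable_realize (φ : BF n) : Decomposable fun M N _ _ xs ys =>
    φ.Realize (default : Empty → M × N) fun i => (xs i, ys i) := by
  induction φ with
  | falsum => exact Decomposable.false
  | equal t s =>
    refine .congr (fun M N _ _ _ _ xs ys => ?_) (.rect (t.bdEqual s) (t.bdEqual s))
    change _ = _ ↔ _
    rw [realize_term_prod, realize_term_prod, Prod.mk.injEq, BoundedFormula.realize_bdEqual,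
      BoundedFormula.realize_bdEqual]
  | @rel _ k R ts =>
    match k, R with
    | 1, _ =>
      refine .congr (fun M N _ _ hM hN xs ys => ?_)
        ((Decomposable.rect (atR.boundedFormula₁ (ts 0)) ((ts 0).bdEqual tb)).or
          (.rect ((ts 0).bdEqual tb) (atR.boundedFormula₁ (ts 0))))
      have h := atE_prod hM hN
        (p := (ts 0).realize (Sum.elim (default : Empty → M × N) fun i => (xs i, ys i)))
      refine Iff.trans Iff.rfl (h.trans ?_)
      rw [realize_term_prod]
      simp only [BoundedFormula.realize_rel₁, BoundedFormula.realize_bdEqual, realize_tb, atE]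
    | 2, true =>
      refine .congr (fun M N _ _ hM hN xs ys => ?_)
        (Decomposable.rect (subR.boundedFormula₂ (ts 0) (ts 1))
          (subR.boundedFormula₂ (ts 0) (ts 1)))
      refine Iff.trans (b := subE
        ((ts 0).realize (Sum.elim (default : Empty → M × N) fun i => (xs i, ys i)))
        ((ts 1).realize (Sum.elim (default : Empty → M × N) fun i => (xs i, ys i)))) Iff.rfl ?_
      rw [subE_prod, realize_term_prod, realize_term_prod]
      simp only [BoundedFormula.realize_rel₂, subE]
    | 2, false =>
      refine .congr (fun M N _ _ hM hN xs ys => ?_)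
        ((Decomposable.rect (∼((ts 0).bdEqual tb)) (∼((ts 1).bdEqual tb))).or
          ((Decomposable.rect (exleR.boundedFormula₂ (ts 0) (ts 1)) ⊤).or
            (.rect ⊤ (exleR.boundedFormula₂ (ts 0) (ts 1)))))
      refine Iff.trans (b := exleE
        ((ts 0).realize (Sum.elim (default : Empty → M × N) fun i => (xs i, ys i)))
        ((ts 1).realize (Sum.elim (default : Empty → M × N) fun i => (xs i, ys i)))) Iff.rfl ?_
      rw [exleE_prod, realize_term_prod, realize_term_prod]
      simp only [BoundedFormula.realize_rel₂, BoundedFormula.realize_bdEqual, realize_tb, exleE,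
        BoundedFormula.realize_not, BoundedFormula.realize_top, and_true, true_and, ne_eq]
  | imp φ ψ hφ hψ =>
    refine .congr (fun M N _ _ _ _ xs ys => ?_) (hφ.not.or hψ)
    rw [BoundedFormula.realize_imp, imp_iff_not_or]
  | all φ hφ =>
    refine .congr (fun M N _ _ _ _ xs ys => ?_) hφ.not.ex.not
    simp only [BoundedFormula.realize_all, snoc_prod, Prod.forall, not_exists, not_not]

theorem realize_bigOr {v : Empty → M} {xs : Fin n → M} (l : List (BF n)) :
    (bigOr l).Realize v xs ↔ ∃ φ ∈ l, φ.Realize v xs := by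
  induction l with
  | nil => simp [bigOr]
  | cons φ l ih =>
    rw [List.exists_mem_cons_iff, ← ih]
    exact BoundedFormula.realize_sup

open Classical in
theorem exists_comp_prod (hM : FinModel M) (hN : FinModel N) (η : BF (n + 1))
    (Y : Fin n → M × N) : ∃ X, ∀ x, atE x → (subE x X ↔ η.Realize default (Fin.snoc Y x)) := by
  obtain ⟨l, hl⟩ := decomposable_realize η
  obtain ⟨A, hA⟩ := hM.comp (bigOr ((l.filter fun p => p.2.Realize default
    (Fin.snoc (fun i => (Y i).2) (botE N))).map Prod.fst)) fun i => (Y i).1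
  obtain ⟨B, hB⟩ := hN.comp (bigOr ((l.filter fun p => p.1.Realize default
    (Fin.snoc (fun i => (Y i).1) (botE M))).map Prod.snd)) fun i => (Y i).2
  have hη (x : M × N) : η.Realize default (Fin.snoc Y x) ↔ ∃ p ∈ l,
      p.1.Realize default (Fin.snoc (fun i => (Y i).1) x.1) ∧
        p.2.Realize default (Fin.snoc (fun i => (Y i).2) x.2) := by
    rw [← hl M N hM hN]
    beta_reduce
    rw [← snoc_prod]
  refine ⟨(A, B), (forall_atE_prod hM hN).2 ⟨fun a ha => ?_, fun b hb => ?_⟩⟩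
  · simp only [subE_prod, hη, hN.bot_le, and_true, hA a ha, realize_bigOr, List.mem_map,
      exists_exists_and_eq_and, List.mem_filter, decide_eq_true_eq]
    exact exists_congr fun p => by tauto
  · simp only [subE_prod, hη, hM.bot_le, true_and, hB b hb, realize_bigOr, List.mem_map,
      exists_exists_and_eq_and, List.mem_filter, decide_eq_true_eq]
    exact exists_congr fun p => by tauto

end FefermanVaught

section Main

variable {M N : Type} [Lmso.Structure M] [Lmso.Structure N]

theorem exleE_inl_inl (hN : FinModel N) {a c : M} :
    exleE (a, botE N) (c, botE N) ↔ exleE a c := by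
  simp [exleE_prod, hN.not_exleE_bot_left]

theorem exleE_inr_inr (hM : FinModel M) {b d : N} :
    exleE (botE M, b) (botE M, d) ↔ exleE b d := by
  simp [exleE_prod, hM.not_exleE_bot_left]

theorem exleE_inl_inr (hM : FinModel M) (hN : FinModel N) {a : M} {d : N} :
    exleE (a, botE N) (botE M, d) ↔ a ≠ botE M ∧ d ≠ botE N := by
  simp [exleE_prod, hM.not_exleE_bot_right, hN.not_exleE_bot_left]

theorem not_exleE_inr_inl (hM : FinModel M) (hN : FinModel N) {b : N} {c : M} :
    ¬ exleE (botE M, b) (c, botE N) := by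
  simp [exleE_prod, hM.not_exleE_bot_left, hN.not_exleE_bot_right]

theorem atE_inl (hM : FinModel M) (hN : FinModel N) {a : M} :
    atE (a, botE N) ↔ atE a := by
  simp [atE_prod hM hN, hN.not_atE_bot]

theorem atE_inr (hM : FinModel M) (hN : FinModel N) {b : N} :
    atE (botE M, b) ↔ atE b := by
  simp [atE_prod hM hN, hM.not_atE_bot]

theorem trans_at_prod (hM : FinModel M) (hN : FinModel N) (p : M × N) (hp : atE p) (q : M × N)
    (hq : atE q) (r : M × N) (hr : atE r) : exleE p q → exleE q r → exleE p r := by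
  revert p q r
  simp only [forall_atE_prod hM hN, exleE_inl_inl hN, exleE_inr_inr hM, exleE_inl_inr hM hN,
    not_exleE_inr_inl hM hN]
  refine ⟨fun a ha => ⟨fun b hb => ⟨fun c hc h1 h2 => ?_, fun c hc _ _ => ?_⟩, fun b hb =>
    ⟨fun c hc _ h => h.elim, fun c hc _ _ => ?_⟩⟩, fun a ha => ⟨fun b hb => ⟨fun c hc h _ => h,
      fun c hc h _ => h.elim⟩, fun b hb => ⟨fun c hc _ h => h, fun c hc h1 h2 => ?_⟩⟩⟩
  · exact hM.trans_at a b c ⟨⟨⟨⟨ha, hb⟩, hc⟩, h1⟩, h2⟩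
  · exact ⟨hM.ne_bot ha, hN.ne_bot hc⟩
  · exact ⟨hM.ne_bot ha, hN.ne_bot hc⟩
  · exact hN.trans_at a b c ⟨⟨⟨⟨ha, hb⟩, hc⟩, h1⟩, h2⟩

theorem exleE_prod_iff (hM : FinModel M) (hN : FinModel N) (p q : M × N) : exleE p q ↔
    ∃ c d, (((atE c ∧ atE d) ∧ subE c p) ∧ subE d q) ∧ exleE c d := by
  have h (c d : M × N) : ((((atE c ∧ atE d) ∧ subE c p) ∧ subE d q) ∧ exleE c d) ↔
      atE c ∧ atE d ∧ subE c p ∧ subE d q ∧ exleE c d := by tauto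
  simp only [h, exists_and_left]
  simp only [exists_atE_prod hM hN, subE_prod, hM.bot_le, hN.bot_le, and_true, true_and,
    exleE_inl_inl hN, exleE_inr_inr hM, exleE_inl_inr hM hN, not_exleE_inr_inl hM hN, and_false,
    exists_false, false_or]
  rw [exleE_prod, hM.exle_iff p.1, hN.exle_iff p.2]
  constructor
  · rintro (⟨ha, hd⟩ | ⟨c, d, ⟨⟨⟨hc, hd⟩, h1⟩, h2⟩, h3⟩ | ⟨c, d, ⟨⟨⟨hc, hd⟩, h1⟩, h2⟩, h3⟩)
    · obtain ⟨a, ha, hap⟩ := hM.atomic _ ha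
      obtain ⟨b, hb, hbq⟩ := hN.atomic _ hd
      exact Or.inl ⟨a, ha, Or.inr ⟨b, hb, hap, hbq, hM.ne_bot ha, hN.ne_bot hb⟩⟩
    · exact Or.inl ⟨c, hc, Or.inl ⟨d, hd, h1, h2, h3⟩⟩
    · exact Or.inr ⟨c, hc, d, hd, h1, h2, h3⟩
  · rintro (⟨c, hc, ⟨d, hd, h1, h2, h3⟩ | ⟨d, hd, h1, h2, -⟩⟩ | ⟨c, hc, d, hd, h1, h2, h3⟩)
    · exact Or.inr (Or.inl ⟨c, d, ⟨⟨⟨hc, hd⟩, h1⟩, h2⟩, h3⟩)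
    · refine Or.inl ⟨fun h => hM.ne_bot hc ?_, fun h => hN.ne_bot hd ?_⟩
      · exact hM.eq_bot (h ▸ h1)
      · exact hN.eq_bot (h ▸ h2)
    · exact Or.inr (Or.inr ⟨c, d, ⟨⟨⟨hc, hd⟩, h1⟩, h2⟩, h3⟩)

theorem isLeastAtomE_inl (hM : FinModel M) (hN : FinModel N) {a : M} (h : IsLeastAtomE a) :
    IsLeastAtomE (a, botE N) := by
  refine ⟨(atE_inl hM hN).2 h.1, (forall_atE_prod hM hN).2 ⟨fun c hc => ?_, fun d _ => ?_⟩⟩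
  · rw [exleE_inl_inl hN]
    exact h.2 c hc
  · exact not_exleE_inr_inl hM hN

theorem isLeastAtomE_inr (hM : FinModel M) (hN : FinModel N) (h0 : ∀ a : M, ¬ atE a) {b : N}
    (h : IsLeastAtomE b) : IsLeastAtomE (botE M, b) := by
  refine ⟨(atE_inr hM hN).2 h.1, (forall_atE_prod hM hN).2
    ⟨fun c hc => (h0 c hc).elim, fun d hd => ?_⟩⟩
  rw [exleE_inr_inr hM]
  exact h.2 d hd

theorem isGreatestAtomE_inr (hM : FinModel M) (hN : FinModel N) {b : N}
    (h : IsGreatestAtomE b) : IsGreatestAtomE (botE M, b) := by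
  refine ⟨(atE_inr hM hN).2 h.1, (forall_atE_prod hM hN).2 ⟨fun c _ => ?_, fun d hd => ?_⟩⟩
  · exact not_exleE_inr_inl hM hN
  · rw [exleE_inr_inr hM]
    exact h.2 d hd

theorem isGreatestAtomE_inl (hM : FinModel M) (hN : FinModel N) (h0 : ∀ b : N, ¬ atE b) {a : M}
    (h : IsGreatestAtomE a) : IsGreatestAtomE (a, botE N) := by
  refine ⟨(atE_inl hM hN).2 h.1, (forall_atE_prod hM hN).2
    ⟨fun c hc => ?_, fun d hd => (h0 d hd).elim⟩⟩
  rw [exleE_inl_inl hN]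
  exact h.2 c hc

theorem isSuccE_inl_inl (hM : FinModel M) (hN : FinModel N) {a c : M} (h : IsSuccE c a) :
    IsSuccE (c, botE N) (a, botE N) := by
  obtain ⟨⟨⟨ha, hc⟩, hac⟩, h⟩ := h
  refine ⟨⟨⟨(atE_inl hM hN).2 ha, (atE_inl hM hN).2 hc⟩, (exleE_inl_inl hN).2 hac⟩, ?_⟩
  simp only [and_imp]
  refine (forall_atE_prod hM hN).2 ⟨fun z hz hz' => ?_, fun z hz _ => Or.inr ?_⟩
  · rw [exleE_inl_inl hN] at hz' ⊢
    simpa using h z ⟨hz, hz'⟩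
  · exact (exleE_inl_inr hM hN).2 ⟨hM.ne_bot hc, hN.ne_bot hz⟩

theorem isSuccE_inr_inr (hM : FinModel M) (hN : FinModel N) {b d : N} (h : IsSuccE d b) :
    IsSuccE (botE M, d) (botE M, b) := by
  obtain ⟨⟨⟨hb, hd⟩, hbd⟩, h⟩ := h
  refine ⟨⟨⟨(atE_inr hM hN).2 hb, (atE_inr hM hN).2 hd⟩, (exleE_inr_inr hM).2 hbd⟩, ?_⟩
  simp only [and_imp]
  refine (forall_atE_prod hM hN).2
    ⟨fun z _ hz' => (not_exleE_inr_inl hM hN hz').elim, fun z hz hz' => ?_⟩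
  rw [exleE_inr_inr hM] at hz' ⊢
  simpa using h z ⟨hz, hz'⟩

theorem isSuccE_inl_inr (hM : FinModel M) (hN : FinModel N) {a : M} {d : N}
    (ha : IsGreatestAtomE a) (hd : IsLeastAtomE d) :
    IsSuccE (botE M, d) (a, botE N) := by
  refine ⟨⟨⟨(atE_inl hM hN).2 ha.1, (atE_inr hM hN).2 hd.1⟩,
    (exleE_inl_inr hM hN).2 ⟨hM.ne_bot ha.1, hN.ne_bot hd.1⟩⟩, ?_⟩
  simp only [and_imp]
  refine (forall_atE_prod hM hN).2 ⟨fun z hz hz' => ?_, fun z hz _ => ?_⟩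
  · exact (ha.2 z hz ((exleE_inl_inl hN).1 hz')).elim
  · rw [exleE_inr_inr hM]
    rcases hN.trich z d ⟨hz, hd.1⟩ with (h | h) | h
    exacts [(hd.2 z hz h).elim, Or.inl (by rw [h]), Or.inr h]

theorem succ_prod (hM : FinModel M) (hN : FinModel N) (p : M × N) (hp : atE p) :
    (∃ q, atE q ∧ exleE p q) → ∃ q, IsSuccE q p := by
  rw [exists_atE_prod hM hN]
  revert p
  refine (forall_atE_prod hM hN).2 ⟨fun a ha => ?_, fun b hb => ?_⟩
  · simp only [exleE_inl_inl hN]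
    intro h
    by_cases h' : ∃ c, atE c ∧ exleE a c
    · obtain ⟨c, hc⟩ := hM.succ a ⟨ha, h'⟩
      exact ⟨_, isSuccE_inl_inl hM hN hc⟩
    · obtain ⟨d, hd, -⟩ := h.resolve_left h'
      obtain ⟨d, hd⟩ := hN.least_atom ⟨d, hd⟩
      exact ⟨_, isSuccE_inl_inr hM hN ⟨ha, fun z hz hz' => h' ⟨z, hz, hz'⟩⟩ hd⟩
  · simp only [not_exleE_inr_inl hM hN, exleE_inr_inr hM, and_false, exists_false, false_or]
    intro h
    obtain ⟨d, hd⟩ := hN.succ b ⟨hb, h⟩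
    exact ⟨_, isSuccE_inr_inr hM hN hd⟩

theorem pred_prod (hM : FinModel M) (hN : FinModel N) (p : M × N) (hp : atE p) :
    (∃ q, atE q ∧ exleE q p) → ∃ q, IsSuccE p q := by
  rw [exists_atE_prod hM hN]
  revert p
  refine (forall_atE_prod hM hN).2 ⟨fun a ha => ?_, fun b hb => ?_⟩
  · simp only [not_exleE_inr_inl hM hN, exleE_inl_inl hN, and_false, exists_false, or_false]
    intro h
    obtain ⟨c, hc⟩ := hM.pred a ⟨ha, h⟩
    exact ⟨_, isSuccE_inl_inl hM hN hc⟩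
  · simp only [exleE_inr_inr hM]
    intro h
    by_cases h' : ∃ d, atE d ∧ exleE d b
    · obtain ⟨d, hd⟩ := hN.pred b ⟨hb, h'⟩
      exact ⟨_, isSuccE_inr_inr hM hN hd⟩
    · obtain ⟨c, hc, -⟩ := h.resolve_right h'
      obtain ⟨c, hc⟩ := hM.greatest_atom ⟨c, hc⟩
      exact ⟨_, isSuccE_inl_inr hM hN hc ⟨hb, fun z hz hz' => h' ⟨z, hz, hz'⟩⟩⟩

theorem least_in_prod (hM : FinModel M) (hN : FinModel N) {p : M × N} (hp : p ≠ botE (M × N)) :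
    ∃ b, (atE b ∧ subE b p) ∧ ∀ c, atE c ∧ subE c p → ¬ exleE c b := by
  simp only [and_imp, and_assoc]
  by_cases h : p.1 = botE M
  · have h2 : p.2 ≠ botE N := fun h2 => hp (Prod.ext h h2)
    obtain ⟨b, ⟨hb, hbp⟩, hb'⟩ := hN.least_in _ h2
    refine ⟨(botE M, b), (atE_inr hM hN).2 hb, ⟨hM.bot_le _, hbp⟩,
      (forall_atE_prod hM hN).2 ⟨fun c hc hcp => ?_, fun d hd hdp => ?_⟩⟩
    · exact (hM.ne_bot hc (hM.eq_bot (h ▸ hcp.1))).elim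
    · rw [exleE_inr_inr hM]
      exact hb' d ⟨hd, hdp.2⟩
  · obtain ⟨a, ⟨ha, hap⟩, ha'⟩ := hM.least_in _ h
    refine ⟨(a, botE N), (atE_inl hM hN).2 ha, ⟨hap, hN.bot_le _⟩,
      (forall_atE_prod hM hN).2 ⟨fun c hc hcp => ?_, fun d _ _ => ?_⟩⟩
    · rw [exleE_inl_inl hN]
      exact ha' c ⟨hc, hcp.1⟩
    · exact not_exleE_inr_inl hM hN

theorem FinModel.prod (hM : FinModel M) (hN : FinModel N) : FinModel (M × N) where
  refl a := ⟨hM.refl _, hN.refl _⟩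
  antisymm a b h := Prod.ext (hM.antisymm _ _ ⟨h.1.1, h.2.1⟩) (hN.antisymm _ _ ⟨h.1.2, h.2.2⟩)
  trans a b c h := ⟨hM.trans _ _ _ ⟨h.1.1, h.2.1⟩, hN.trans _ _ _ ⟨h.1.2, h.2.2⟩⟩
  bot_le a := ⟨hM.bot_le _, hN.bot_le _⟩
  top := by
    obtain ⟨s, hs⟩ := hM.top
    obtain ⟨t, ht⟩ := hN.top
    exact ⟨(s, t), fun b => ⟨hs _, ht _⟩⟩
  meet a b := by
    obtain ⟨c, hc⟩ := hM.meet a.1 b.1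
    obtain ⟨d, hd⟩ := hN.meet a.2 b.2
    exact ⟨(c, d), (isMeetE_prod hM hN).2 ⟨hc, hd⟩⟩
  join a b := by
    obtain ⟨c, hc⟩ := hM.join a.1 b.1
    obtain ⟨d, hd⟩ := hN.join a.2 b.2
    exact ⟨(c, d), (isJoinE_prod hM hN).2 ⟨hc, hd⟩⟩
  compl a := by
    obtain ⟨c, hc⟩ := hM.compl a.1
    obtain ⟨d, hd⟩ := hN.compl a.2
    exact ⟨(c, d), isComplE_prod hc hd⟩
  distrib a b c d e f g h := by
    simp only [isMeetE_prod hM hN, isJoinE_prod hM hN]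
    rintro ⟨⟨⟨⟨h1, h2⟩, h3⟩, h4⟩, h5⟩
    exact ⟨hM.distrib _ _ _ _ _ _ _ _ ⟨⟨⟨⟨h1.1, h2.1⟩, h3.1⟩, h4.1⟩, h5.1⟩,
      hN.distrib _ _ _ _ _ _ _ _ ⟨⟨⟨⟨h1.2, h2.2⟩, h3.2⟩, h4.2⟩, h5.2⟩⟩
  at_iff p := by
    simp only [atE_prod_def, botE_prod, subE_prod, and_imp]
  atomic p hp := by
    obtain ⟨b, hb, -⟩ := least_in_prod hM hN hp
    exact ⟨b, hb⟩
  irrefl := by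
    refine (forall_atE_prod hM hN).2 ⟨fun a ha => ?_, fun b hb => ?_⟩
    · rw [exleE_inl_inl hN]
      exact hM.irrefl a ha
    · rw [exleE_inr_inr hM]
      exact hN.irrefl b hb
  trans_at p q r h := trans_at_prod hM hN p h.1.1.1.1 q h.1.1.1.2 r h.1.1.2 h.1.2 h.2
  trich p q h := by
    obtain ⟨hp, hq⟩ := h
    revert q
    revert p
    refine (forall_atE_prod hM hN).2 ⟨fun a ha => ?_, fun b hb => ?_⟩ <;>
      refine (forall_atE_prod hM hN).2 ⟨fun c hc => ?_, fun d hd => ?_⟩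
    · simpa [exleE_inl_inl hN] using hM.trich a c ⟨ha, hc⟩
    · exact Or.inl (Or.inl ((exleE_inl_inr hM hN).2 ⟨hM.ne_bot ha, hN.ne_bot hd⟩))
    · exact Or.inr ((exleE_inl_inr hM hN).2 ⟨hM.ne_bot hc, hN.ne_bot hb⟩)
    · simpa [exleE_inr_inr hM] using hN.trich b d ⟨hb, hd⟩
  exle_iff := exleE_prod_iff hM hN
  comp := exists_comp_prod hM hN
  least_atom := by
    rintro ⟨p, hp⟩
    by_cases h : ∃ a : M, atE a
    · obtain ⟨a, ha⟩ := hM.least_atom h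
      exact ⟨_, isLeastAtomE_inl hM hN ha⟩
    · have h' : ∃ b : N, atE b := by
        rcases (atE_prod hM hN).1 hp with hp | hp
        exacts [(h ⟨_, hp.1⟩).elim, ⟨_, hp.2⟩]
      obtain ⟨b, hb⟩ := hN.least_atom h'
      exact ⟨_, isLeastAtomE_inr hM hN (not_exists.1 h) hb⟩
  greatest_atom := by
    rintro ⟨p, hp⟩
    by_cases h : ∃ b : N, atE b
    · obtain ⟨b, hb⟩ := hN.greatest_atom h
      exact ⟨_, isGreatestAtomE_inr hM hN hb⟩
    · have h' : ∃ a : M, atE a := by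
        rcases (atE_prod hM hN).1 hp with hp | hp
        exacts [⟨_, hp.1⟩, (h ⟨_, hp.2⟩).elim]
      obtain ⟨a, ha⟩ := hM.greatest_atom h'
      exact ⟨_, isGreatestAtomE_inl hM hN (not_exists.1 h) ha⟩
  succ p h := succ_prod hM hN p h.1 h.2
  pred p h := pred_prod hM hN p h.1 h.2
  least_in p hp := least_in_prod hM hN hp

theorem completeTheory_prod_congr {M' N' : Type} [Lmso.Structure M'] [Lmso.Structure N']
    (hM : FinModel M) (hN : FinModel N) (hM' : FinModel M') (hN' : FinModel N')
    (h : Lmso.completeTheory M = Lmso.completeTheory M')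
    (h' : Lmso.completeTheory N = Lmso.completeTheory N') :
    Lmso.completeTheory (M × N) = Lmso.completeTheory (M' × N') := by
  ext φ
  rw [mem_completeTheory, mem_completeTheory]
  obtain ⟨l, hl⟩ := decomposable_realize φ
  have key (K L : Type) [Lmso.Structure K] [Lmso.Structure L] (hK : FinModel K)
      (hL : FinModel L) : (K × L) ⊨ φ ↔
        ∃ p ∈ l, p.1 ∈ Lmso.completeTheory K ∧ p.2 ∈ Lmso.completeTheory L := by
    refine Iff.trans ?_ (hl K L hK hL default default)
    rw [Sentence.Realize, Formula.Realize]
    exact iff_of_eq (congrArg _ (Subsingleton.elim _ _))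
  rw [key M N hM hN, key M' N' hM' hN', h, h']

theorem completeTheory_eq_of_isComplete {T : Lmso.Theory} (hT : T.IsComplete) {M M' : Type}
    [Lmso.Structure M] [Lmso.Structure M'] (hM : M ⊨ T) (hM' : M' ⊨ T) :
    Lmso.completeTheory M = Lmso.completeTheory M' := by
  have : Nonempty M := ⟨botE M⟩
  have : Nonempty M' := ⟨botE M'⟩
  ext φ
  rw [mem_completeTheory, mem_completeTheory, hT.realize_sentence_iff φ M,
    hT.realize_sentence_iff φ M']

end Main

theorem statement9 (T T' : Lmso.Theory) (hT : T.IsComplete) (hT' : T'.IsComplete)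
    (hTe : TMSOFin ⊆ T) (hT'e : TMSOFin ⊆ T') :
    (∀ (M N M' N' : Type) [Lmso.Structure M] [Lmso.Structure N]
        [Lmso.Structure M'] [Lmso.Structure N'],
      M ⊨ T → N ⊨ T' → M' ⊨ T → N' ⊨ T' →
        Lmso.completeTheory (M × N) = Lmso.completeTheory (M' × N')) ∧
    (∀ (M N : Type) [Lmso.Structure M] [Lmso.Structure N], M ⊨ T → N ⊨ T' →
      (Lmso.completeTheory (M × N)).IsComplete ∧
        TMSOFin ⊆ Lmso.completeTheory (M × N)) := by
  have fin {K : Type} [Lmso.Structure K] {S : Lmso.Theory} (hS : TMSOFin ⊆ S) (hK : K ⊨ S) :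
      FinModel K := finModel_iff.1 (hK.mono hS)
  constructor
  · intro M N M' N' _ _ _ _ hM hN hM' hN'
    exact completeTheory_prod_congr (fin hTe hM) (fin hT'e hN) (fin hTe hM') (fin hT'e hN')
      (completeTheory_eq_of_isComplete hT hM hM') (completeTheory_eq_of_isComplete hT' hN hN')
  · intro M N _ _ hM hN
    have : Nonempty (M × N) := ⟨botE (M × N)⟩
    exact ⟨completeTheory.isComplete Lmso (M × N), Theory.model_iff_subset_completeTheory.1
      (finModel_iff.2 ((fin hTe hM).prod (fin hT'e hN)))⟩

end MSO
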